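/- (Pull-back) Let N, q be positive integers and h0, h1 : ℤ/Nℤ → ℤ, with H0 the circulant matrix of h0 (entries h0(j−i)) and H1 the reverse circulant matrix of h1 (entries h1(i+j)). Suppose the pair (f0′, g0′) lies in the lattice L_{h0+h1} spanned by the rows of [[I_N, H0+H1],[0, q·I_N]] and the pair (f1′, g1′) lies in the lattice L_{h0−h1} spanned by the rows of [[I_N, H0−H1],[0, q·I_N]]. Then the quadruple (f0′+f1′, f0′−f1′, g0′+g1′, g0′−g1′) lies in the lattice L_h spanned by the rows of the 4N×4N block matrix [[I_{2N}, H],[0, q·I_{2N}]] with H = [[H0,H1],[H1,H0]]. -/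

import Mathlib

/-- The circulant matrix of a vector `h0 : ZMod N → ℤ`, with `(i, j)` entry `h0 (j - i)`. -/
def circMat (N : ℕ) (h0 : ZMod N → ℤ) : Matrix (ZMod N) (ZMod N) ℤ :=
  Matrix.of fun i j => h0 (j - i)

/-- The reverse circulant matrix of a vector `h1 : ZMod N → ℤ`, with `(i, j)` entry
`h1 (i + j)`. -/
def revCircMat (N : ℕ) (h1 : ZMod N → ℤ) : Matrix (ZMod N) (ZMod N) ℤ :=
  Matrix.of fun i j => h1 (i + j)

/-- The NTRU lattice of an `ι × ι` integer matrix `M` with modulus `q`: the `ℤ`-submodule of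
`(ι → ℤ) × (ι → ℤ)` spanned by the rows of the block matrix `[[I, M], [0, q•I]]`, each row
being split into its left and right halves. -/
def ntruLattice {ι : Type*} [Fintype ι] [DecidableEq ι] (q : ℕ) (M : Matrix ι ι ℤ) :
    Submodule ℤ ((ι → ℤ) × (ι → ℤ)) :=
  Submodule.span ℤ (Set.range fun i : ι ⊕ ι =>
    ((fun j => (Matrix.fromBlocks 1 M 0 ((q : ℤ) • 1) : Matrix (ι ⊕ ι) (ι ⊕ ι) ℤ) i (Sum.inl j),
      fun j => (Matrix.fromBlocks 1 M 0 ((q : ℤ) • 1) : Matrix (ι ⊕ ι) (ι ⊕ ι) ℤ) i (Sum.inr j)) :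
      (ι → ℤ) × (ι → ℤ)))

theorem mem_ntruLattice_iff {ι : Type*} [Fintype ι] [DecidableEq ι] {q : ℕ} {M : Matrix ι ι ℤ}
    {f g : ι → ℤ} :
    (f, g) ∈ ntruLattice q M ↔ ∃ u : ι → ℤ, g = Matrix.vecMul f M + (q : ℤ) • u := by
  have key : ∀ c : ι ⊕ ι → ℤ,
      ∑ i, c i •
        ((fun j => (Matrix.fromBlocks 1 M 0 ((q : ℤ) • 1) :
            Matrix (ι ⊕ ι) (ι ⊕ ι) ℤ) i (Sum.inl j),
          fun j => (Matrix.fromBlocks 1 M 0 ((q : ℤ) • 1) :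
            Matrix (ι ⊕ ι) (ι ⊕ ι) ℤ) i (Sum.inr j)) : (ι → ℤ) × (ι → ℤ)) =
        (c ∘ Sum.inl, Matrix.vecMul (c ∘ Sum.inl) M + (q : ℤ) • (c ∘ Sum.inr)) := by
    intro c
    ext j <;>
      simp [Prod.fst_sum, Prod.snd_sum, Matrix.vecMul, dotProduct, Matrix.one_apply, Matrix.natCast_apply,
        mul_comm]
  rw [ntruLattice, Submodule.mem_span_range_iff_exists_fun]
  simp only [key, Prod.mk.injEq]
  constructor
  · rintro ⟨c, rfl, rfl⟩
    exact ⟨_, rfl⟩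
  · rintro ⟨u, rfl⟩
    exact ⟨Sum.elim f u, by simp⟩

/-- Pull-back: if `(f0', g0') ∈ L_{h0+h1}` and `(f1', g1') ∈ L_{h0−h1}`, then the quadruple
`(f0'+f1', f0'−f1', g0'+g1', g0'−g1')` lies in the dihedral NTRU lattice `L_h` spanned by
the rows of `[[I, H], [0, q·I]]` with `H = [[H0, H1], [H1, H0]]`. -/
theorem pullback_mem_ntruLattice (N q : ℕ) [NeZero N] (hq : 0 < q)
    (h0 h1 f0' f1' g0' g1' : ZMod N → ℤ)
    (hmem0 : (f0', g0') ∈ ntruLattice q (circMat N h0 + revCircMat N h1))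
    (hmem1 : (f1', g1') ∈ ntruLattice q (circMat N h0 - revCircMat N h1)) :
    (Sum.elim (f0' + f1') (f0' - f1'), Sum.elim (g0' + g1') (g0' - g1')) ∈
      ntruLattice q (Matrix.fromBlocks (circMat N h0) (revCircMat N h1)
        (revCircMat N h1) (circMat N h0)) := by
  obtain ⟨u, rfl⟩ := mem_ntruLattice_iff.mp hmem0
  obtain ⟨v, rfl⟩ := mem_ntruLattice_iff.mp hmem1
  refine mem_ntruLattice_iff.mpr ⟨Sum.elim (u + v) (u - v), ?_⟩
  rw [Matrix.vecMul_fromBlocks]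
  ext (j | j) <;>
    simp [Matrix.vecMul_add, Matrix.vecMul_sub, Matrix.add_vecMul, Matrix.sub_vecMul] <;> ring
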